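/- Let γ be a skew shape and t ≥ 2 an integer with (t+1, t) ∈ LR(γ). Then either γ coincides, up to planar translation, with the Young diagram of (t+1, t) or with the 180°-rotation of that Young diagram, or LR(γ) ∩ {(t+1, t−1, 1), (t+2, t−1), (t, t, 1)} ≠ ∅. -/

import Mathlib

open scoped Classical

namespace SylowBranching

/-- The cells of the Young diagram of `f` (rows indexed by the first coordinate,
starting from `0`; `f i` is the length of row `i`). -/
def cellsOf (f : ℕ → ℕ) : Set (ℕ × ℕ) := {p | p.2 < f p.1}

/-- `f : ℕ → ℕ` is a partition if it is weakly decreasing with finitely many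
nonzero parts.  Its parts are `f 0 ≥ f 1 ≥ ⋯`, and its largest part is `f 0`. -/
def IsPartition (f : ℕ → ℕ) : Prop :=
  Antitone f ∧ ∃ N, ∀ i, N ≤ i → f i = 0

/-- The size `|f|` of a partition: the number of cells of its Young diagram. -/
noncomputable def psize (f : ℕ → ℕ) : ℕ := (cellsOf f).ncard

/-- `P(n)`: the set of partitions of `n`. -/
def Pset (n : ℕ) : Set (ℕ → ℕ) := {f | IsPartition f ∧ psize f = n}

/-- The conjugate (transpose) partition `f'`. -/
noncomputable def conj (f : ℕ → ℕ) : ℕ → ℕ := fun j => Set.ncard {i | j < f i}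

/-- `A° = A ∪ A'`: the closure of a set of partitions under conjugation. -/
noncomputable def conjClosure (A : Set (ℕ → ℕ)) : Set (ℕ → ℕ) := A ∪ conj '' A

/-- `B_n(t)`: partitions of `n` with largest part at most `t` and at most `t` parts. -/
noncomputable def Bset (n t : ℕ) : Set (ℕ → ℕ) :=
  {f ∈ Pset n | f 0 ≤ t ∧ conj f 0 ≤ t}

/-- The cells of the skew shape `l / m`. -/
def skewCells (l m : ℕ → ℕ) : Set (ℕ × ℕ) :=
  {p | m p.1 ≤ p.2 ∧ p.2 < l p.1}

/-- `d` is read before (or at the same time as) `c` in the reading order of a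
filling: right-to-left along rows, rows from top to bottom. -/
def readBefore (d c : ℕ × ℕ) : Prop :=
  d.1 < c.1 ∨ (d.1 = c.1 ∧ c.2 ≤ d.2)

/-- A Littlewood–Richardson filling of the cell set `γ` of weight `ν`:
all entries are positive; for every `j ≥ 1` there are exactly `ν (j-1)` entries
equal to `j` (i.e. the number of `j`s is the `j`-th part of `ν`); entries weakly
increase along rows and strictly increase down columns; and every initial
segment of the reading word (right-to-left along rows, top to bottom) contains
at least as many entries equal to `j` as entries equal to `j+1`, for all `j ≥ 1`. -/
structure IsLRFilling (γ : Set (ℕ × ℕ)) (ν : ℕ → ℕ) (T : ℕ × ℕ → ℕ) : Prop where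
  pos : ∀ c ∈ γ, 1 ≤ T c
  weight : ∀ j : ℕ, 1 ≤ j → Set.ncard {c ∈ γ | T c = j} = ν (j - 1)
  row_weak : ∀ i j j', (i, j) ∈ γ → (i, j') ∈ γ → j ≤ j' → T (i, j) ≤ T (i, j')
  col_strict : ∀ i i' j, (i, j) ∈ γ → (i', j) ∈ γ → i < i' → T (i, j) < T (i', j)
  lattice : ∀ c ∈ γ, ∀ j : ℕ, 1 ≤ j →
    Set.ncard {d ∈ γ | T d = j + 1 ∧ readBefore d c} ≤
      Set.ncard {d ∈ γ | T d = j ∧ readBefore d c}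

/-- `LR(γ)`: the set of all weights of LR fillings of `γ`. -/
def LRset (γ : Set (ℕ × ℕ)) : Set (ℕ → ℕ) := {ν | ∃ T, IsLRFilling γ ν T}

/-- The Littlewood–Richardson coefficient `c^l_{m ν}`: the number of LR fillings
of the skew shape `l / m` of weight `ν` (zero unless `m ⊆ l`); fillings are
normalised to vanish off the skew shape so that they can be counted. -/
noncomputable def LRcoeff (l m ν : ℕ → ℕ) : ℕ :=
  Set.ncard {T : ℕ × ℕ → ℕ |
    (∀ i, m i ≤ l i) ∧ (∀ c, c ∉ skewCells l m → T c = 0) ∧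
      IsLRFilling (skewCells l m) ν T}

/-- The `⋆` operation on sets of partitions:
`A ⋆ B = {λ : c^λ_{μν} > 0 for some μ ∈ A, ν ∈ B}`. -/
def starOp (A B : Set (ℕ → ℕ)) : Set (ℕ → ℕ) :=
  {l | IsPartition l ∧ ∃ μ ∈ A, ∃ ν ∈ B, 0 < LRcoeff l μ ν}

/-- The partition with the given (weakly decreasing) list of parts. -/
def ofList (L : List ℕ) : ℕ → ℕ := fun i => L.getD i 0

/-- The hook partition `(a, 1^b)`. -/
def hookP (a b : ℕ) : ℕ → ℕ := ofList (a :: List.replicate b 1)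

/-- The partition `(a, μ)` obtained by prepending a first part `a` to `μ`. -/
def consPart (a : ℕ) (μ : ℕ → ℕ) : ℕ → ℕ := fun i => if i = 0 then a else μ (i - 1)

/-- `γ` coincides, up to planar translation, with the Young diagram of `ν`. -/
def TranslateOf (γ : Set (ℕ × ℕ)) (ν : ℕ → ℕ) : Prop :=
  ∃ a b : ℕ, γ = (fun p : ℕ × ℕ => (p.1 + a, p.2 + b)) '' cellsOf ν

/-- `γ` coincides, up to planar translation, with the 180°-rotation of the
Young diagram of `ν`. -/
def RotationOf (γ : Set (ℕ × ℕ)) (ν : ℕ → ℕ) : Prop :=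
  ∃ a b : ℕ, (∀ p ∈ cellsOf ν, p.1 ≤ a ∧ p.2 ≤ b) ∧
    γ = (fun p : ℕ × ℕ => (a - p.1, b - p.2)) '' cellsOf ν

/-- Iterated Littlewood–Richardson coefficients `c^l_{μ^1, …, μ^r}`:
`c^l_{μ} = δ_{l μ}`, and the coefficient for a longer list is obtained by
summing, over partitions `g` of the total size of the remaining factors, the
product of the iterated coefficient of `g` with `c^l_{g μ}`. -/
noncomputable def iterLR : List (ℕ → ℕ) → (ℕ → ℕ) → ℕ
  | [], l => if l = (fun _ => 0 : ℕ → ℕ) then 1 else 0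
  | [μ], l => if l = μ then 1 else 0
  | μ :: μs, l =>
      ∑' g : {g : ℕ → ℕ // IsPartition g ∧ psize g = (μs.map psize).sum},
        iterLR μs g.1 * LRcoeff l g.1 μ

/-- `D(q, m, B)`: partitions `λ` of `qm` with `c^λ_{μ_1, …, μ_q} > 0` for some
`μ_1, …, μ_q ∈ B` that are not all equal. -/
noncomputable def Dset (q m : ℕ) (B : Set (ℕ → ℕ)) : Set (ℕ → ℕ) :=
  {l ∈ Pset (q * m) | ∃ μ : Fin q → (ℕ → ℕ),
    (∀ i, μ i ∈ B) ∧ (∃ i j, μ i ≠ μ j) ∧ 0 < iterLR (List.ofFn μ) l}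

/-- Iterated `⋆` of a list of sets of partitions. -/
def starAll : List (Set (ℕ → ℕ)) → Set (ℕ → ℕ)
  | [] => Pset 0
  | [A] => A
  | A :: B :: rest => starOp A (starAll (B :: rest))

/-- `Ω(φ(1,0,…,0))` for the Sylow 3-subgroup of `S_{3^k}` (`k ≥ 4`):
`B_{3^k}(2a) ∖ {(2a, a−1, 1), (2a, 2, 1^{a−2}), (2a−1, a+1), (2a−1, 1^{a+1})}°`
where `a = 3^{k−1}`. -/
noncomputable def Cset (k : ℕ) : Set (ℕ → ℕ) :=
  Bset (3 ^ k) (2 * 3 ^ (k - 1)) \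
    conjClosure
      {ofList [2 * 3 ^ (k - 1), 3 ^ (k - 1) - 1, 1],
       ofList (2 * 3 ^ (k - 1) :: 2 :: List.replicate (3 ^ (k - 1) - 2) 1),
       ofList [2 * 3 ^ (k - 1) - 1, 3 ^ (k - 1) + 1],
       hookP (2 * 3 ^ (k - 1) - 1) (3 ^ (k - 1) + 1)}

theorem IsPartition.finite_skewCells {l : ℕ → ℕ} (hl : IsPartition l) (m : ℕ → ℕ) :
    (skewCells l m).Finite := by
  obtain ⟨hanti, N, hN⟩ := hl
  refine ((Set.finite_Iio N).prod (Set.finite_Iio (l 0))).subset ?_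
  rintro ⟨i, j⟩ ⟨-, h⟩
  simp only [Set.mem_prod, Set.mem_Iio] at h ⊢
  refine ⟨?_, h.trans_le (hanti (Nat.zero_le i))⟩
  by_contra hi
  rw [hN i (not_lt.mp hi)] at h
  omega

/-- The cells of `γ` filled by the entry `j`. -/
def entryCells (γ : Set (ℕ × ℕ)) (T : ℕ × ℕ → ℕ) (j : ℕ) : Set (ℕ × ℕ) := {c ∈ γ | T c = j}

theorem mem_entryCells {γ : Set (ℕ × ℕ)} {T : ℕ × ℕ → ℕ} {j : ℕ} {c : ℕ × ℕ} :
    c ∈ entryCells γ T j ↔ c ∈ γ ∧ T c = j := Iff.rfl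

theorem finite_entryCells {γ : Set (ℕ × ℕ)} (hγ : γ.Finite) (T : ℕ × ℕ → ℕ) (j : ℕ) :
    (entryCells γ T j).Finite := hγ.subset fun _ hc => hc.1

/-- A filling by `1`, `2` and at most one `3` is Littlewood–Richardson as soon as the lattice
condition holds for the entries `1`, `2`, and the `3` is preceded by some `2`. -/
theorem IsLRFilling.of_le_three {γ : Set (ℕ × ℕ)} (hγ : γ.Finite) {T : ℕ × ℕ → ℕ} {a b e : ℕ}
    (hval : ∀ c ∈ γ, T c = 1 ∨ T c = 2 ∨ T c = 3)
    (hone : (entryCells γ T 1).ncard = a) (htwo : (entryCells γ T 2).ncard = b)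
    (hthree : (entryCells γ T 3).ncard = e) (he : e ≤ 1)
    (hrow : ∀ i j j', (i, j) ∈ γ → (i, j') ∈ γ → j ≤ j' → T (i, j) ≤ T (i, j'))
    (hcol : ∀ i i' j, (i, j) ∈ γ → (i', j) ∈ γ → i < i' → T (i, j) < T (i', j))
    (hlat : ∀ c ∈ γ, {d ∈ γ | T d = 2 ∧ readBefore d c}.ncard ≤
      {d ∈ γ | T d = 1 ∧ readBefore d c}.ncard)
    (hlat' : ∀ c ∈ γ, ∀ d ∈ γ, T d = 3 → readBefore d c →
      ∃ x ∈ γ, T x = 2 ∧ readBefore x c) :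
    IsLRFilling γ (ofList [a, b, e]) T where
  pos c hc := by rcases hval c hc with h | h | h <;> omega
  weight j hj := by
    obtain rfl | rfl | rfl | hj : j = 1 ∨ j = 2 ∨ j = 3 ∨ 4 ≤ j := by omega
    · exact hone
    · exact htwo
    · exact hthree
    · have hempty : {c ∈ γ | T c = j} = ∅ := by
        ext c
        simp only [Set.mem_ofPred_eq, Set.mem_empty_iff_false, iff_false, not_and]
        intro hc
        rcases hval c hc with h | h | h <;> omega
      rw [hempty, Set.ncard_empty, ofList, List.getD_eq_default]
      simp only [List.length_cons, List.length_nil]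
      omega
  row_weak := hrow
  col_strict := hcol
  lattice c hc j hj := by
    obtain rfl | rfl | hj : j = 1 ∨ j = 2 ∨ 3 ≤ j := by omega
    · exact hlat c hc
    · obtain hempty | ⟨d, hd, hd3, hdc⟩ :=
        {d ∈ γ | T d = 2 + 1 ∧ readBefore d c}.eq_empty_or_nonempty
      · rw [hempty, Set.ncard_empty]
        exact Nat.zero_le _
      · obtain ⟨x, hx⟩ := hlat' c hc d hd hd3 hdc
        have hpos : 0 < {d ∈ γ | T d = 2 ∧ readBefore d c}.ncard :=
          (Set.ncard_pos (hγ.subset (Set.sep_subset _ _))).mpr ⟨x, hx⟩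
        have hle : {d ∈ γ | T d = 2 + 1 ∧ readBefore d c}.ncard ≤ (entryCells γ T 3).ncard :=
          Set.ncard_le_ncard (fun y hy => ⟨hy.1, hy.2.1⟩) (hγ.subset (Set.sep_subset _ _))
        omega
    · have hempty : {d ∈ γ | T d = j + 1 ∧ readBefore d c} = ∅ := by
        ext d
        simp only [Set.mem_ofPred_eq, Set.mem_empty_iff_false, iff_false, not_and]
        intro hd
        rcases hval d hd with h | h | h <;> omega
      rw [hempty, Set.ncard_empty]
      exact Nat.zero_le _

theorem ofList_append_zero (a b : ℕ) : ofList [a, b, 0] = ofList [a, b] := by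
  funext i
  rcases i with _ | _ | _ | i <;> rfl

section TwoRow

variable {γ : Set (ℕ × ℕ)} {T : ℕ × ℕ → ℕ} {a b : ℕ}

theorem IsLRFilling.eq_one_or_two (hγ : γ.Finite) (hT : IsLRFilling γ (ofList [a, b]) T)
    {c : ℕ × ℕ} (hc : c ∈ γ) : T c = 1 ∨ T c = 2 := by
  by_contra hne
  have hpos := hT.pos c hc
  have hw := hT.weight (T c) hpos
  rw [ofList, List.getD_eq_default _ _ (by simp only [List.length_cons, List.length_nil]; omega),
    Set.ncard_eq_zero (hγ.subset (Set.sep_subset _ _))] at hw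
  exact (Set.eq_empty_iff_forall_notMem.mp hw) c ⟨hc, rfl⟩

/-- Lowering the leftmost `2` of a row to a `1` when no box lies above it. -/
theorem IsLRFilling.lower_two (hγ : γ.Finite) (hT : IsLRFilling γ (ofList [a, b]) T)
    {i j : ℕ} (hc : (i, j) ∈ γ) (hTc : T (i, j) = 2)
    (hleft : ∀ j' < j, (i, j') ∈ γ → T (i, j') ≠ 2) (habove : ∀ i' < i, (i', j) ∉ γ) :
    ofList [a + 1, b - 1] ∈ LRset γ := by
  have hval : ∀ c ∈ γ, T c = 1 ∨ T c = 2 := fun c hc => hT.eq_one_or_two hγ hc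
  have hw₁ : (entryCells γ T 1).ncard = a := hT.weight 1 le_rfl
  have hw₂ : (entryCells γ T 2).ncard = b := hT.weight 2 one_le_two
  have hrow := hT.row_weak
  have hcol := hT.col_strict
  rw [← ofList_append_zero]
  refine ⟨Function.update T (i, j) 1, .of_le_three hγ ?_ ?_ ?_ ?_ zero_le_one ?_ ?_ ?_ ?_⟩
  · intro c hc
    rcases hval c hc with h | h <;> grind [Function.update_apply]
  · have heq : entryCells γ (Function.update T (i, j) 1) 1 =
        insert (i, j) (entryCells γ T 1) := by
      ext c
      grind [mem_entryCells, Function.update_apply]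
    rw [heq, Set.ncard_insert_of_notMem (by simp [mem_entryCells, hTc]) (finite_entryCells hγ T 1),
      hw₁]
  · have heq : entryCells γ (Function.update T (i, j) 1) 2 = entryCells γ T 2 \ {(i, j)} := by
      ext c
      grind [mem_entryCells, Function.update_apply]
    rw [heq, Set.ncard_sdiff_singleton_of_mem (mem_entryCells.mpr ⟨hc, hTc⟩), hw₂]
  · have heq : entryCells γ (Function.update T (i, j) 1) 3 = ∅ := by
      ext c
      grind [mem_entryCells, Function.update_apply]
    rw [heq, Set.ncard_empty]
  · intro x y y' h h' hy
    have := hrow x y y' h h' hy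
    grind [Function.update_apply]
  · intro x x' y h h' hx
    have := hcol x x' y h h' hx
    grind [Function.update_apply]
  · intro c hc
    refine (Set.ncard_le_ncard ?_ (hγ.subset (Set.sep_subset _ _))).trans
      ((hT.lattice c hc 1 le_rfl).trans
        (Set.ncard_le_ncard ?_ (hγ.subset (Set.sep_subset _ _)))) <;>
    · intro x
      simp only [Set.mem_ofPred_eq]
      grind [Function.update_apply]
  · grind [Function.update_apply]

/-- Raising to a `3` the rightmost `2` of a row when an earlier row contains a `2`. -/
theorem IsLRFilling.raise_two (hγ : γ.Finite) (hT : IsLRFilling γ (ofList [a, b]) T)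
    {i j : ℕ} (hc : (i, j) ∈ γ) (hTc : T (i, j) = 2)
    (hright : ∀ j', j < j' → (i, j') ∈ γ → T (i, j') ≠ 2)
    {d : ℕ × ℕ} (hd : d ∈ γ) (hTd : T d = 2) (hdi : d.1 < i) :
    ofList [a, b - 1, 1] ∈ LRset γ := by
  have hval : ∀ c ∈ γ, T c = 1 ∨ T c = 2 := fun c hc => hT.eq_one_or_two hγ hc
  have hw₁ : (entryCells γ T 1).ncard = a := hT.weight 1 le_rfl
  have hw₂ : (entryCells γ T 2).ncard = b := hT.weight 2 one_le_two
  have hrow := hT.row_weak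
  have hcol := hT.col_strict
  refine ⟨Function.update T (i, j) 3, .of_le_three hγ ?_ ?_ ?_ ?_ le_rfl ?_ ?_ ?_ ?_⟩
  · intro c hc
    rcases hval c hc with h | h <;> grind [Function.update_apply]
  · rw [← hw₁]
    congr 1
    ext c
    grind [mem_entryCells, Function.update_apply]
  · have heq : entryCells γ (Function.update T (i, j) 3) 2 = entryCells γ T 2 \ {(i, j)} := by
      ext c
      grind [mem_entryCells, Function.update_apply]
    rw [heq, Set.ncard_sdiff_singleton_of_mem (mem_entryCells.mpr ⟨hc, hTc⟩), hw₂]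
  · have heq : entryCells γ (Function.update T (i, j) 3) 3 = {(i, j)} := by
      ext c
      grind [mem_entryCells, Function.update_apply]
    rw [heq, Set.ncard_singleton]
  · intro x y y' h h' hy
    have := hrow x y y' h h' hy
    grind [Function.update_apply]
  · intro x x' y h h' hx
    have := hcol x x' y h h' hx
    grind [Function.update_apply]
  · intro c hc
    refine (Set.ncard_le_ncard ?_ (hγ.subset (Set.sep_subset _ _))).trans
      ((hT.lattice c hc 1 le_rfl).trans
        (Set.ncard_le_ncard ?_ (hγ.subset (Set.sep_subset _ _)))) <;>
    · intro x
      simp only [Set.mem_ofPred_eq]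
      grind [Function.update_apply]
  · intro c _ x hx hTx hxc
    have hxij : x = (i, j) := by grind [Function.update_apply]
    subst hxij
    refine ⟨d, hd, ?_, ?_⟩
    · grind [Function.update_apply]
    · simp only [readBefore] at hxc ⊢
      omega

/-- Raising to a `3` a `1` that is alone in the last row. -/
theorem IsLRFilling.raise_last_one (hγ : γ.Finite) (hT : IsLRFilling γ (ofList [a + 1, a]) T)
    {s : ℕ × ℕ} (hs : s ∈ γ) (hTs : T s = 1) (hlast : ∀ c ∈ γ, c ≠ s → c.1 < s.1)
    {d : ℕ × ℕ} (hd : d ∈ γ) (hTd : T d = 2) :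
    ofList [a, a, 1] ∈ LRset γ := by
  have hval : ∀ c ∈ γ, T c = 1 ∨ T c = 2 := fun c hc => hT.eq_one_or_two hγ hc
  have hw₁ : (entryCells γ T 1).ncard = a + 1 := hT.weight 1 le_rfl
  have hw₂ : (entryCells γ T 2).ncard = a := hT.weight 2 one_le_two
  have hrow := hT.row_weak
  have hcol := hT.col_strict
  have hones : (entryCells γ (Function.update T s 3) 1).ncard = a := by
    have heq : entryCells γ (Function.update T s 3) 1 = entryCells γ T 1 \ {s} := by
      ext c
      grind [mem_entryCells, Function.update_apply]
    rw [heq, Set.ncard_sdiff_singleton_of_mem (mem_entryCells.mpr ⟨hs, hTs⟩), hw₁,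
      Nat.add_sub_cancel]
  have htwos : entryCells γ (Function.update T s 3) 2 = entryCells γ T 2 := by
    ext c
    grind [mem_entryCells, Function.update_apply]
  refine ⟨Function.update T s 3, .of_le_three hγ ?_ hones (htwos ▸ hw₂) ?_ le_rfl ?_ ?_ ?_ ?_⟩
  · intro c hc
    rcases hval c hc with h | h <;> grind [Function.update_apply]
  · have heq : entryCells γ (Function.update T s 3) 3 = {s} := by
      ext c
      grind [mem_entryCells, Function.update_apply]
    rw [heq, Set.ncard_singleton]
  · intro x y y' h h' hy
    have := hrow x y y' h h' hy
    have := hlast _ h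
    have := hlast _ h'
    grind [Function.update_apply]
  · intro x x' y h h' hx
    have := hcol x x' y h h' hx
    have := hlast _ h
    have := hlast _ h'
    grind [Function.update_apply]
  · intro c hc
    by_cases hcs : c = s
    · subst hcs
      have hbefore : ∀ x ∈ γ, readBefore x c := by
        intro x hx
        by_cases hxc : x = c
        · exact hxc ▸ Or.inr ⟨rfl, le_rfl⟩
        · exact Or.inl (hlast x hx hxc)
      have heq₁ : {x ∈ γ | Function.update T c 3 x = 1 ∧ readBefore x c} =
          entryCells γ (Function.update T c 3) 1 := by
        ext x
        grind [mem_entryCells]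
      have heq₂ : {x ∈ γ | Function.update T c 3 x = 2 ∧ readBefore x c} =
          entryCells γ (Function.update T c 3) 2 := by
        ext x
        grind [mem_entryCells]
      rw [heq₁, heq₂, hones, htwos, hw₂]
    · have hsc : ¬ readBefore s c := by
        have := hlast c hc hcs
        simp only [readBefore]
        omega
      refine (Set.ncard_le_ncard ?_ (hγ.subset (Set.sep_subset _ _))).trans
        ((hT.lattice c hc 1 le_rfl).trans
          (Set.ncard_le_ncard ?_ (hγ.subset (Set.sep_subset _ _)))) <;>
      · intro x
        simp only [Set.mem_ofPred_eq]
        grind [Function.update_apply]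
  · intro c _ x hx hTx hxc
    have hxs : x = s := by grind [Function.update_apply]
    subst hxs
    have hdx : d ≠ x := by rintro rfl; omega
    refine ⟨d, hd, ?_, ?_⟩
    · grind [Function.update_apply]
    · have := hlast d hd hdx
      simp only [readBefore] at hxc ⊢
      omega

/-- A `2 × a` rectangle with an isolated `1` in a row above it: the last column of the rectangle
can be refilled with `2` over `3`. -/
theorem IsLRFilling.raise_last_column (hγ : γ.Finite)
    (hT : IsLRFilling γ (ofList [a + 1, a]) T) {s : ℕ × ℕ} (hs : s ∈ γ) (hTs : T s = 1)
    {k e : ℕ} (hsk : s.1 < k) (hke : (k, e) ∈ γ) (hke' : (k + 1, e) ∈ γ)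
    (htop : ∀ c ∈ γ, T c = 1 → c = s ∨ (c.1 = k ∧ c.2 ≤ e ∧ (k + 1, c.2) ∈ γ))
    (hbot : ∀ c ∈ γ, T c = 2 → c.1 = k + 1 ∧ c.2 ≤ e ∧ (k, c.2) ∈ γ) :
    ofList [a, a, 1] ∈ LRset γ := by
  have hval : ∀ c ∈ γ, T c = 1 ∨ T c = 2 := fun c hc => hT.eq_one_or_two hγ hc
  have hw₁ : (entryCells γ T 1).ncard = a + 1 := hT.weight 1 le_rfl
  have hw₂ : (entryCells γ T 2).ncard = a := hT.weight 2 one_le_two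
  have hrow := hT.row_weak
  have hcol := hT.col_strict
  have hTke : T (k, e) = 1 := by
    rcases hval _ hke with h | h
    · exact h
    · have := (hbot _ hke h).1
      simp at this
  have hTke' : T (k + 1, e) = 2 := by
    have := hcol k (k + 1) e hke hke' (Nat.lt_succ_self k)
    have := hval _ hke'
    omega
  obtain ⟨T', hT'⟩ : ∃ T' : ℕ × ℕ → ℕ,
      ∀ c, T' c = if c = (k, e) then 2 else if c = (k + 1, e) then 3 else T c := ⟨_, fun _ => rfl⟩
  have hones : (entryCells γ T' 1).ncard = a := by
    have heq : entryCells γ T' 1 = entryCells γ T 1 \ {(k, e)} := by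
      ext c
      grind [mem_entryCells]
    rw [heq, Set.ncard_sdiff_singleton_of_mem (mem_entryCells.mpr ⟨hke, hTke⟩), hw₁,
      Nat.add_sub_cancel]
  have htwos : (entryCells γ T' 2).ncard = a := by
    have heq : entryCells γ T' 2 = insert (k, e) (entryCells γ T 2 \ {(k + 1, e)}) := by
      ext c
      grind [mem_entryCells]
    have hpos : 0 < (entryCells γ T 2).ncard :=
      (Set.ncard_pos (hγ.subset (Set.sep_subset _ _))).mpr ⟨_, hke', hTke'⟩
    rw [heq, Set.ncard_insert_of_notMem (by simp [mem_entryCells, hTke])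
      ((finite_entryCells hγ T 2).subset Set.sdiff_subset),
      Set.ncard_sdiff_singleton_of_mem (mem_entryCells.mpr ⟨hke', hTke'⟩)]
    omega
  refine ⟨T', .of_le_three hγ ?_ hones htwos ?_ le_rfl ?_ ?_ ?_ ?_⟩
  · intro c hc
    rcases hval c hc with h | h <;> grind
  · have heq : entryCells γ T' 3 = {(k + 1, e)} := by
      ext c
      grind [mem_entryCells]
    rw [heq, Set.ncard_singleton]
  · intro x y y' h h' hy
    have := hrow x y y' h h' hy
    have := hval _ h
    have := hval _ h'
    grind
  · intro x x' y h h' hx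
    have := hcol x x' y h h' hx
    have := hval _ h
    have := hval _ h'
    grind
  · intro c hc
    by_cases hck : c.1 ≤ k
    · have hsub : {d ∈ γ | T' d = 2 ∧ readBefore d c} ⊆ {(k, e)} := by
        rintro d ⟨hd, hd2, hdc⟩
        simp only [readBefore] at hdc
        grind
      obtain hempty | ⟨d, hd⟩ := {d ∈ γ | T' d = 2 ∧ readBefore d c}.eq_empty_or_nonempty
      · rw [hempty, Set.ncard_empty]
        exact Nat.zero_le _
      · have hde : d = (k, e) := hsub hd
        subst hde
        have hkc := hd.2.2
        refine (Set.ncard_le_ncard hsub).trans ?_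
        rw [Set.ncard_singleton, Nat.one_le_iff_ne_zero, ← Nat.pos_iff_ne_zero,
          Set.ncard_pos (hγ.subset (Set.sep_subset _ _))]
        refine ⟨s, hs, ?_, ?_⟩
        · grind
        · simp only [readBefore] at hkc ⊢
          omega
    · have heq : {d ∈ γ | T' d = 1 ∧ readBefore d c} = entryCells γ T' 1 := by
        ext d
        simp only [mem_entryCells, Set.mem_ofPred_eq]
        refine ⟨fun h => ⟨h.1, h.2.1⟩, fun h => ⟨h.1, h.2, Or.inl ?_⟩⟩
        grind
      rw [heq, hones, ← htwos]
      exact Set.ncard_le_ncard (fun y hy => ⟨hy.1, hy.2.1⟩) (hγ.subset (Set.sep_subset _ _))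
  · intro c _ x hx hTx hxc
    have hxe : x = (k + 1, e) := by grind
    subst hxe
    refine ⟨(k, e), hke, by grind, ?_⟩
    simp only [readBefore] at hxc ⊢
    omega

end TwoRow

/-- If every `2` lies below a box and all the `2`s lie in row `k + 1`, then the shape consists of
a `2 × b` rectangle in rows `k`, `k + 1` and of one further box, which is filled by `1`. -/
theorem IsLRFilling.exists_rectangle {l m : ℕ → ℕ} (hl : IsPartition l) (hm : IsPartition m)
    {T : ℕ × ℕ → ℕ} {b k : ℕ}
    (hT : IsLRFilling (skewCells l m) (ofList [b + 1, b]) T)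
    (hrow : ∀ c ∈ skewCells l m, T c = 2 → c.1 = k + 1 ∧ (k, c.2) ∈ skewCells l m) (hb : 0 < b) :
    l (k + 1) = m k + b ∧ ∃ s, T s = 1 ∧
      (∀ c, c ∈ skewCells l m ↔
        c = s ∨ ((c.1 = k ∨ c.1 = k + 1) ∧ m k ≤ c.2 ∧ c.2 < m k + b)) ∧
      (s.1 = k ∨ s.1 = k + 1 → ¬ (m k ≤ s.2 ∧ s.2 < m k + b)) ∧
      ∀ c ∈ skewCells l m, T c = 2 ↔ (c.1 = k + 1 ∧ m k ≤ c.2) := by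
  have hγ := hl.finite_skewCells m
  have hval : ∀ c ∈ skewCells l m, T c = 1 ∨ T c = 2 := fun c hc => hT.eq_one_or_two hγ hc
  have hw₁ : (entryCells (skewCells l m) T 1).ncard = b + 1 := hT.weight 1 le_rfl
  have hw₂ : (entryCells (skewCells l m) T 2).ncard = b := hT.weight 2 one_le_two
  have hlk : l (k + 1) ≤ l k := hl.1 (Nat.le_succ k)
  have hmk : m (k + 1) ≤ m k := hm.1 (Nat.le_succ k)
  have hcol : ∀ j, m k ≤ j → j < l (k + 1) → (k, j) ∈ skewCells l m ∧
      (k + 1, j) ∈ skewCells l m ∧ T (k, j) = 1 ∧ T (k + 1, j) = 2 := by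
    intro j h h'
    have h₁ : (k, j) ∈ skewCells l m := ⟨h, h'.trans_le hlk⟩
    have h₂ : (k + 1, j) ∈ skewCells l m := ⟨hmk.trans h, h'⟩
    have := hT.col_strict k (k + 1) j h₁ h₂ (Nat.lt_succ_self k)
    have := hval _ h₁
    have := hval _ h₂
    exact ⟨h₁, h₂, by omega, by omega⟩
  have htwos : entryCells (skewCells l m) T 2 =
      (fun j => (k + 1, j)) '' Set.Ico (m k) (l (k + 1)) := by
    ext ⟨i, j⟩
    constructor
    · rintro ⟨hc, hc2⟩
      obtain ⟨hi, hk⟩ := hrow _ hc hc2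
      simp only at hi hk
      subst hi
      exact ⟨j, ⟨hk.1, hc.2⟩, rfl⟩
    · rintro ⟨j', ⟨h, h'⟩, heq⟩
      rw [← heq]
      exact ⟨(hcol j' h h').2.1, (hcol j' h h').2.2.2⟩
  have hlen : l (k + 1) - m k = b := by
    rw [← hw₂, htwos, Set.ncard_image_of_injective _ (fun x y h => (Prod.mk.inj h).2)]
    simp [Set.ncard_eq_toFinset_card']
  have hlen' : l (k + 1) = m k + b := by omega
  have hsub : (fun j => (k, j)) '' Set.Ico (m k) (l (k + 1)) ⊆ entryCells (skewCells l m) T 1 := by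
    rintro _ ⟨j, ⟨h, h'⟩, rfl⟩
    exact ⟨(hcol j h h').1, (hcol j h h').2.2.1⟩
  have hdiff : (entryCells (skewCells l m) T 1 \
      (fun j => (k, j)) '' Set.Ico (m k) (l (k + 1))).ncard = 1 := by
    rw [Set.ncard_sdiff hsub, hw₁,
      Set.ncard_image_of_injective _ (fun x y h => (Prod.mk.inj h).2)]
    simp [Set.ncard_eq_toFinset_card', hlen']
  obtain ⟨s, hs⟩ := Set.ncard_eq_one.mp hdiff
  have hone : ∀ c, (c ∈ skewCells l m ∧ T c = 1) ∧ ¬ (c.1 = k ∧ m k ≤ c.2 ∧ c.2 < m k + b) ↔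
      c = s := by
    intro c
    rw [← Set.mem_singleton_iff (a := c), ← hs, Set.mem_sdiff, hlen']
    refine and_congr Iff.rfl (not_congr ⟨?_, ?_⟩)
    · rintro ⟨rfl, h, h'⟩
      exact ⟨c.2, ⟨h, h'⟩, rfl⟩
    · rintro ⟨j, ⟨h, h'⟩, rfl⟩
      exact ⟨rfl, h, h'⟩
  have htwo : ∀ c ∈ skewCells l m, T c = 2 ↔ (c.1 = k + 1 ∧ m k ≤ c.2) := by
    rintro ⟨i, j⟩ hc
    constructor
    · intro h
      obtain ⟨hi, hk⟩ := hrow _ hc h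
      exact ⟨hi, hk.1⟩
    · rintro ⟨hi, hj⟩
      simp only at hi hj
      subst hi
      exact (hcol j hj hc.2).2.2.2
  have hsmem := (hone s).mpr rfl
  rw [hlen'] at hcol
  refine ⟨hlen', s, hsmem.1.2, ?_, ?_, htwo⟩
  · rintro ⟨i, j⟩
    constructor
    · intro hc
      rcases hval _ hc with h | h
      · have := hone (i, j)
        tauto
      · have := (htwo _ hc).mp h
        have hj := hc.2
        simp only at this hj
        rw [this.1] at hj
        exact Or.inr ⟨Or.inr this.1, this.2, by omega⟩
    · rintro (h | ⟨h | h, h', h''⟩)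
      · exact h ▸ hsmem.1.1
      · simp only at h h' h''
        subst h
        exact (hcol j h' h'').1
      · simp only at h h' h''
        subst h
        exact (hcol j h' h'').2.1
  · rintro (h | h) h'
    · exact hsmem.2 ⟨h, h'⟩
    · have := (htwo s hsmem.1.1).mpr ⟨h, h'.1⟩
      omega

theorem mem_cellsOf_pair {a b : ℕ} {c : ℕ × ℕ} :
    c ∈ cellsOf (ofList [a, b]) ↔ (c.1 = 0 ∧ c.2 < a) ∨ (c.1 = 1 ∧ c.2 < b) := by
  obtain ⟨i, j⟩ := c
  rcases i with _ | _ | i <;> simp [cellsOf, ofList]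

/-- if `γ = l/m` is a skew shape, `t ≥ 2` and `(t+1, t) ∈ LR(γ)`,
then `γ` is, up to planar translation, the Young diagram of `(t+1, t)` or its
180°-rotation, or `LR(γ)` meets `{(t+1, t−1, 1), (t+2, t−1), (t, t, 1)}`. -/
theorem lr_tworow_filling_balanced (t : ℕ) (ht : 2 ≤ t)
    (l m : ℕ → ℕ) (hl : IsPartition l) (hm : IsPartition m) (hml : ∀ i, m i ≤ l i)
    (h : ofList [t + 1, t] ∈ LRset (skewCells l m)) :
    TranslateOf (skewCells l m) (ofList [t + 1, t]) ∨
    RotationOf (skewCells l m) (ofList [t + 1, t]) ∨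
    (LRset (skewCells l m) ∩
      {ofList [t + 1, t - 1, 1], ofList [t + 2, t - 1], ofList [t, t, 1]}).Nonempty := by
  obtain ⟨T, hT⟩ := h
  have hγ := hl.finite_skewCells m
  have hw₂ : (entryCells (skewCells l m) T 2).ncard = t := hT.weight 2 one_le_two
  have hfin₂ : (entryCells (skewCells l m) T 2).Finite := hγ.subset (Set.sep_subset _ _)
  by_cases hA : ∃ i j, (i, j) ∈ skewCells l m ∧ T (i, j) = 2 ∧ ∀ i' < i, (i', j) ∉ skewCells l m
  · obtain ⟨i, j, hc, hTc, habove⟩ := hA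
    have hex : ∃ j, (i, j) ∈ skewCells l m ∧ T (i, j) = 2 := ⟨j, hc, hTc⟩
    have hle : Nat.find hex ≤ j := Nat.find_min' hex ⟨hc, hTc⟩
    refine Or.inr (Or.inr ⟨ofList [t + 1 + 1, t - 1], hT.lower_two hγ (Nat.find_spec hex).1
      (Nat.find_spec hex).2 (fun j' h h' h'' => Nat.find_min hex h ⟨h', h''⟩) ?_, by simp⟩)
    intro i' hi' hmem
    exact habove i' hi' ⟨hmem.1.trans hle, hc.2.trans_le (hl.1 hi'.le)⟩
  have hup : ∀ i j, (i, j) ∈ skewCells l m → T (i, j) = 2 →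
      ∃ k, i = k + 1 ∧ (k, j) ∈ skewCells l m := by
    intro i j hc hTc
    by_contra hk
    refine hA ⟨i, j, hc, hTc, fun i' hi' hmem => hk ⟨i - 1, by omega, ?_, ?_⟩⟩
    · exact (hm.1 (show i' ≤ i - 1 by omega)).trans hmem.1
    · exact hc.2.trans_le (hl.1 (show i - 1 ≤ i by omega))
  by_cases hB : ∃ c ∈ skewCells l m, ∃ d ∈ skewCells l m, T c = 2 ∧ T d = 2 ∧ d.1 < c.1
  · obtain ⟨⟨i, j⟩, hc, d, hd, hTc, hTd, hdc⟩ := hB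
    obtain ⟨⟨x, j'⟩, ⟨⟨hc', hTc'⟩, hxi⟩, hmax⟩ :=
      Set.exists_max_image {c | (c ∈ skewCells l m ∧ T c = 2) ∧ c.1 = i} Prod.snd
        (hfin₂.subset fun c h => h.1) ⟨(i, j), ⟨hc, hTc⟩, rfl⟩
    simp only at hxi
    subst hxi
    refine Or.inr (Or.inr ⟨ofList [t + 1, t - 1, 1],
      hT.raise_two hγ hc' hTc' (fun y hy hmem hTy => ?_) hd hTd hdc, by simp⟩)
    have := hmax (x, y) ⟨⟨hmem, hTy⟩, rfl⟩
    simp only at this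
    omega
  obtain ⟨⟨i, j⟩, hc, hTc⟩ : (entryCells (skewCells l m) T 2).Nonempty := by
    rw [← Set.ncard_pos hfin₂]
    omega
  obtain ⟨k, rfl, -⟩ := hup i j hc hTc
  have hrow : ∀ c ∈ skewCells l m, T c = 2 → c.1 = k + 1 ∧ (k, c.2) ∈ skewCells l m := by
    rintro ⟨x, y⟩ hx hTx
    obtain ⟨k', rfl, hk'⟩ := hup x y hx hTx
    have h₁ : ¬ k' + 1 < k + 1 := fun hlt => hB ⟨_, hc, _, hx, hTc, hTx, hlt⟩
    have h₂ : ¬ k + 1 < k' + 1 := fun hlt => hB ⟨_, hx, _, hc, hTx, hTc, hlt⟩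
    obtain rfl : k' = k := by omega
    exact ⟨rfl, hk'⟩
  obtain ⟨hlen, ⟨p, q⟩, hTs, hmem, hout, htwo⟩ := hT.exists_rectangle hl hm hrow (by omega)
  have hs : (p, q) ∈ skewCells l m := (hmem _).mpr (Or.inl rfl)
  have hone : ∀ c ∈ skewCells l m, T c = 1 → ¬ (c.1 = k + 1 ∧ m k ≤ c.2) := by
    intro c hc h₁ h₂
    have := (htwo c hc).mpr h₂
    omega
  obtain hp | rfl | rfl | hp : p < k ∨ p = k ∨ p = k + 1 ∨ k + 1 < p := by omega
  · refine Or.inr (Or.inr ⟨ofList [t, t, 1], hT.raise_last_column hγ hs hTs (k := k)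
      (e := m k + t - 1) hp ?_ ?_ ?_ ?_, by simp⟩)
    · exact (hmem _).mpr (Or.inr ⟨Or.inl rfl, by dsimp only; omega, by dsimp only; omega⟩)
    · exact (hmem _).mpr (Or.inr ⟨Or.inr rfl, by dsimp only; omega, by dsimp only; omega⟩)
    · intro c hc h₁
      have h₂ := hone c hc h₁
      rcases (hmem c).mp hc with h | ⟨h | h, h', h''⟩
      · exact Or.inl h
      · exact Or.inr ⟨h, by omega, (hmem _).mpr (Or.inr ⟨Or.inr rfl, h', h''⟩)⟩
      · exact absurd ⟨h, h'⟩ h₂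
    · intro c hc h₂
      obtain ⟨h, h'⟩ := hrow c hc h₂
      refine ⟨h, ?_, h'⟩
      have := hc.2
      rw [h] at this
      omega
  · left
    have hq : q = m p + t := by
      have h₁ := hs.1
      have h₂ := hs.2
      have h₃ := hout (Or.inl rfl)
      simp only at h₁ h₂ h₃
      have hmem' : (p, m p + t) ∈ skewCells l m := ⟨by simp, by simp only; omega⟩
      rcases (hmem _).mp hmem' with h | h
      · exact (Prod.mk.inj h).2.symm
      · simp only at h; omega
    refine ⟨p, m p, ?_⟩
    ext ⟨x, y⟩
    simp only [hmem, hq, Set.mem_image, mem_cellsOf_pair, Prod.mk.injEq, Prod.exists]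
    constructor
    · intro h
      exact ⟨x - p, y - m p, by omega, by omega⟩
    · rintro ⟨u, v, h, h'⟩
      omega
  · right; left
    have hq : q + 1 = m k := by
      have h₁ := hs.1
      have h₂ := hs.2
      have h₃ := hout (Or.inr rfl)
      simp only at h₁ h₂ h₃
      have hmem' : (k + 1, m k - 1) ∈ skewCells l m := ⟨by simp only; omega, by simp only; omega⟩
      rcases (hmem _).mp hmem' with h | h
      · have := (Prod.mk.inj h).2
        omega
      · simp only at h; omega
    refine ⟨k + 1, m k + t - 1, ?_, ?_⟩
    · intro c hc
      rw [mem_cellsOf_pair] at hc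
      omega
    ext ⟨x, y⟩
    simp only [hmem, Set.mem_image, mem_cellsOf_pair, Prod.mk.injEq, Prod.exists]
    constructor
    · intro h
      exact ⟨k + 1 - x, m k + t - 1 - y, by omega, by omega⟩
    · rintro ⟨u, v, h, h'⟩
      omega
  · refine Or.inr (Or.inr ⟨ofList [t, t, 1], hT.raise_last_one hγ hs hTs ?_ hc hTc, by simp⟩)
    intro c hc hne
    rcases (hmem c).mp hc with h | h
    · exact absurd h hne
    · simp only; omega

end SylowBranching
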